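/- Let p > 1. For u > 0 define g_p(u) = ∑_{m=1}^∞ ∑_{n=1}^∞ 1/(m² + n²·u²)^p. Then, as u → ∞, g_p(u) = (√π·Γ(p − ½)·ζ(2p − 1))/(2·Γ(p)) · u^{-(2p−1)} + O(u^{-2p}), where ζ is the Riemann zeta function and Γ is the Gamma function; that is, there exist C > 0 and u₀ > 0 such that |g_p(u) − (√π·Γ(p − ½)·ζ(2p − 1))/(2·Γ(p))·u^{1−2p}| ≤ C·u^{-2p} for u ≥ u₀. -/

import Mathlib

open Real Filter

open MeasureTheory in
lemma aux_gauss (p : ℝ) {t : ℝ} (ht : 0 < t) :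
    ∫ x in Set.Ioi (0:ℝ), t ^ (p - 1) * Real.exp (-((1 + x ^ 2) * t))
      = √π / 2 * (Real.exp (-t) * t ^ ((p - 1 / 2) - 1)) := by
  have h : ∀ x : ℝ, t ^ (p - 1) * Real.exp (-((1 + x ^ 2) * t))
      = (t ^ (p - 1) * Real.exp (-t)) * Real.exp (-t * x ^ 2) := by
    intro x
    rw [mul_assoc, ← Real.exp_add]
    ring_nf
  simp_rw [h]
  rw [integral_const_mul, integral_gaussian_Ioi, Real.sqrt_div' _ ht.le]
  have h2 : t ^ (p - 1) = t ^ ((p - 1 / 2) - 1) * √t := by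
    rw [Real.sqrt_eq_rpow, ← Real.rpow_add ht]
    ring_nf
  rw [h2]
  have : √t ≠ 0 := (Real.sqrt_pos.2 ht).ne'
  field_simp

open MeasureTheory in
lemma aux_integral (p : ℝ) (hp : 1 < p) :
    ∫ x in Set.Ioi (0:ℝ), (1 + x ^ 2) ^ (-p)
      = √π * Real.Gamma (p - 1 / 2) / (2 * Real.Gamma p) := by
  have hG : 0 < Real.Gamma p := Real.Gamma_pos_of_pos (by linarith)
  have hFint : Integrable (Function.uncurry fun t x : ℝ =>
      t ^ (p - 1) * Real.exp (-((1 + x ^ 2) * t)))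
      ((volume.restrict (Set.Ioi (0:ℝ))).prod (volume.restrict (Set.Ioi (0:ℝ)))) := by
    rw [integrable_prod_iff (by
      apply Measurable.aestronglyMeasurable
      unfold Function.uncurry
      fun_prop)]
    constructor
    · filter_upwards [ae_restrict_mem measurableSet_Ioi] with t ht
      have ht : 0 < t := ht
      have h := ((integrable_exp_neg_mul_sq ht).const_mul
        (t ^ (p - 1) * Real.exp (-t))).restrict (s := Set.Ioi 0)
      refine h.congr (Eventually.of_forall fun x => ?_)
      simp only [Function.uncurry]
      rw [mul_assoc, ← Real.exp_add]
      ring_nf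
    · have h := (Real.GammaIntegral_convergent (s := p - 1 / 2) (by linarith)).const_mul (√π / 2)
      refine Integrable.congr h ?_
      filter_upwards [ae_restrict_mem measurableSet_Ioi] with t ht
      have ht : 0 < t := ht
      rw [← aux_gauss p ht]
      refine integral_congr_ae (Eventually.of_forall fun x => ?_)
      simp only [Function.uncurry]
      rw [Real.norm_of_nonneg (by positivity)]
  have hsw := integral_integral_swap hFint
  have hL : ∫ t in Set.Ioi (0:ℝ), ∫ x in Set.Ioi (0:ℝ),
      t ^ (p - 1) * Real.exp (-((1 + x ^ 2) * t)) = √π / 2 * Real.Gamma (p - 1 / 2) := by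
    rw [Real.Gamma_eq_integral (by linarith), ← integral_const_mul]
    exact setIntegral_congr_fun measurableSet_Ioi fun t ht => aux_gauss p ht
  have hR : ∫ x in Set.Ioi (0:ℝ), ∫ t in Set.Ioi (0:ℝ),
      t ^ (p - 1) * Real.exp (-((1 + x ^ 2) * t))
      = (∫ x in Set.Ioi (0:ℝ), (1 + x ^ 2) ^ (-p)) * Real.Gamma p := by
    rw [← integral_mul_const]
    refine setIntegral_congr_fun measurableSet_Ioi fun x hx => ?_
    have h1 : 0 < 1 + x ^ 2 := by positivity
    rw [integral_rpow_mul_exp_neg_mul_Ioi (by linarith) h1, one_div, Real.inv_rpow h1.le,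
      Real.rpow_neg h1.le]
  rw [hL, hR] at hsw
  rw [eq_div_iff (by positivity)]
  linarith

lemma aux_scale (p : ℝ) {a : ℝ} (ha : 0 < a) (x : ℝ) :
    1 / (x ^ 2 + a ^ 2) ^ p = a ^ (-(2 * p)) * (1 + (a⁻¹ * x) ^ 2) ^ (-p) := by
  have h : x ^ 2 + a ^ 2 = a ^ 2 * (1 + (a⁻¹ * x) ^ 2) := by field_simp; ring
  rw [h, Real.mul_rpow (by positivity) (by positivity), Real.rpow_neg (by positivity),
    Real.rpow_neg (by positivity), Real.rpow_mul ha.le, Real.rpow_two]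
  field_simp

open MeasureTheory in
lemma aux_int (p : ℝ) (hp : 1 < p) {a : ℝ} (ha : 0 < a) :
    IntegrableOn (fun x : ℝ => 1 / (x ^ 2 + a ^ 2) ^ p) (Set.Ioi 0) ∧
    ∫ x in Set.Ioi (0:ℝ), 1 / (x ^ 2 + a ^ 2) ^ p
      = √π * Real.Gamma (p - 1 / 2) / (2 * Real.Gamma p) * a ^ (1 - 2 * p) := by
  simp_rw [aux_scale p ha]
  have h0 : Integrable (fun x : ℝ => (1 + x ^ 2) ^ (-p)) := by
    have := integrable_rpow_neg_one_add_norm_sq (E := ℝ) (μ := volume) (r := 2 * p)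
      (by simp; linarith)
    refine this.congr (Eventually.of_forall fun x => ?_)
    simp only [Real.norm_eq_abs, sq_abs]
    congr 1
    ring
  constructor
  · exact ((h0.comp_mul_left' (inv_ne_zero ha.ne')).const_mul _).integrableOn
  · rw [integral_const_mul,
      integral_comp_mul_left_Ioi (fun x : ℝ => (1 + x ^ 2) ^ (-p)) 0 (inv_pos.2 ha),
      mul_zero, aux_integral p hp, inv_inv, smul_eq_mul]
    have : a ^ (1 - 2 * p) = a ^ (-(2 * p)) * a := by
      rw [← Real.rpow_add_one ha.ne']; ring_nf
    rw [this]; ring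

lemma aux_sum (p : ℝ) (hp : 1 < p) {a : ℝ} (ha : 0 < a) :
    Summable (fun m : ℕ => 1 / (((m : ℝ) + 1) ^ 2 + a ^ 2) ^ p) ∧
    ∑' m : ℕ, 1 / (((m : ℝ) + 1) ^ 2 + a ^ 2) ^ p
      ≤ √π * Real.Gamma (p - 1 / 2) / (2 * Real.Gamma p) * a ^ (1 - 2 * p) ∧
    √π * Real.Gamma (p - 1 / 2) / (2 * Real.Gamma p) * a ^ (1 - 2 * p) - a ^ (-(2 * p))
      ≤ ∑' m : ℕ, 1 / (((m : ℝ) + 1) ^ 2 + a ^ 2) ^ p := by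
  obtain ⟨hi, he⟩ := aux_int p hp ha
  have anti : AntitoneOn (fun x : ℝ => 1 / (x ^ 2 + a ^ 2) ^ p) (Set.Ici 0) := by
    intro x hx y hy hxy
    have hx : 0 ≤ x := hx
    simp only
    gcongr
  have nn : ∀ t ∈ Set.Ioi (0:ℝ), 0 ≤ 1 / (t ^ 2 + a ^ 2) ^ p := fun t _ => by positivity
  have hs := anti.summable_of_integrableOn_Ioi_zero hi nn
  have h1 := anti.tsum_add_one_le_integral hi nn
  have h2 := anti.integral_le_tsum hs nn
  rw [hs.tsum_eq_zero_add] at h2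
  rw [he] at h1 h2
  have hs' := (summable_nat_add_iff 1).2 hs
  have h3 : 1 / (((0:ℕ):ℝ) ^ 2 + a ^ 2) ^ p = a ^ (-(2 * p)) := by
    rw [aux_scale p ha]; simp
  rw [h3] at h2
  push_cast at hs' h1 h2
  exact ⟨hs', h1, by linarith⟩

lemma aux_zeta (s : ℝ) (hs : 1 < s) :
    HasSum (fun n : ℕ => ((n : ℝ) + 1) ^ (-s)) (riemannZeta (s : ℂ)).re := by
  have hsum : Summable (fun n : ℕ => ((n : ℝ) + 1) ^ (-s)) := by
    have := (summable_nat_add_iff 1).2 (Real.summable_nat_rpow.2 (by linarith : -s < -1))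
    simpa using this
  have h : riemannZeta (s : ℂ) = ((∑' n : ℕ, ((n : ℝ) + 1) ^ (-s) : ℝ) : ℂ) := by
    rw [zeta_eq_tsum_one_div_nat_add_one_cpow (by simpa using hs), Complex.ofReal_tsum]
    refine tsum_congr fun n => ?_
    rw [Complex.ofReal_cpow (by positivity)]
    push_cast
    rw [Complex.cpow_neg, one_div]
  rw [h, Complex.ofReal_re]
  exact hsum.hasSum

/-- For p > 1 and g_p(u) = ∑_{m,n=1}^∞ 1/(m² + n²u²)^p, as u → ∞,
g_p(u) = (√π·Γ(p−½)·ζ(2p−1))/(2Γ(p)) · u^{-(2p−1)} + O(u^{-2p}). -/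
theorem stmt_5 (p : ℝ) (hp : 1 < p) :
    ∃ C > (0 : ℝ), ∃ u₀ > (0 : ℝ), ∀ u ≥ u₀,
      |(∑' m : ℕ, ∑' n : ℕ,
          1 / (((m : ℝ) + 1) ^ 2 + ((n : ℝ) + 1) ^ 2 * u ^ 2) ^ p)
        - Real.sqrt Real.pi * Real.Gamma (p - 1 / 2)
            * (riemannZeta ((2 * p - 1 : ℝ) : ℂ)).re / (2 * Real.Gamma p)
            * u ^ (1 - 2 * p)|
        ≤ C * u ^ (-(2 * p)) := by
  have hz1 := aux_zeta (2 * p - 1) (by linarith)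
  have hz2 := aux_zeta (2 * p) (by linarith)
  set Z := (riemannZeta ((2 * p - 1 : ℝ) : ℂ)).re
  set D := (riemannZeta ((2 * p : ℝ) : ℂ)).re
  have hD : 0 ≤ D := hz2.nonneg fun n => by positivity
  refine ⟨D + 1, by linarith, 1, one_pos, fun u hu => ?_⟩
  have hu0 : 0 < u := by linarith
  set I := √π * Real.Gamma (p - 1 / 2) / (2 * Real.Gamma p) with hI
  have key : ∀ n : ℕ, _ := fun n => aux_sum p hp (a := ((n : ℝ) + 1) * u) (by positivity)
  have e1 : ∀ n : ℕ, (((n : ℝ) + 1) * u) ^ (1 - 2 * p)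
      = ((n : ℝ) + 1) ^ (-(2 * p - 1)) * u ^ (1 - 2 * p) := fun n => by
    rw [Real.mul_rpow (by positivity) hu0.le]; ring_nf
  have e2 : ∀ n : ℕ, (((n : ℝ) + 1) * u) ^ (-(2 * p))
      = ((n : ℝ) + 1) ^ (-(2 * p)) * u ^ (-(2 * p)) := fun n => by
    rw [Real.mul_rpow (by positivity) hu0.le]
  simp only [e1, e2, mul_pow, ← hI] at key
  have H1 := (hz1.mul_right (u ^ (1 - 2 * p))).mul_left I
  have H2 := hz2.mul_right (u ^ (-(2 * p)))
  have hS : Summable (fun n : ℕ => ∑' m : ℕ,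
      1 / (((m : ℝ) + 1) ^ 2 + ((n : ℝ) + 1) ^ 2 * u ^ 2) ^ p) :=
    Summable.of_nonneg_of_le (fun n => tsum_nonneg fun m => by positivity)
      (fun n => (key n).2.1) H1.summable
  have hprod : Summable (Function.uncurry fun n m : ℕ =>
      1 / (((m : ℝ) + 1) ^ 2 + ((n : ℝ) + 1) ^ 2 * u ^ 2) ^ p) := by
    rw [summable_prod_of_nonneg (fun x => by
      simp only [Function.uncurry, Pi.zero_apply]; positivity)]
    exact ⟨fun n => (key n).1, hS⟩
  rw [hprod.tsum_comm]
  have hup := hasSum_le (fun n => (key n).2.1) hS.hasSum H1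
  have hlo := hasSum_le (fun n => (key n).2.2) (H1.sub H2) hS.hasSum
  have hc : √π * Real.Gamma (p - 1 / 2) * Z / (2 * Real.Gamma p) * u ^ (1 - 2 * p)
      = I * (Z * u ^ (1 - 2 * p)) := by rw [hI]; ring
  rw [hc, abs_le]
  have hpos : 0 < u ^ (-(2 * p)) := by positivity
  have : (D + 1) * u ^ (-(2 * p)) = D * u ^ (-(2 * p)) + u ^ (-(2 * p)) := by ring
  have : 0 ≤ D * u ^ (-(2 * p)) := by positivity
  constructor <;> linarith
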